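/- FWER control of the sequential step-up Shaffer procedure. Let ℋ be finite with raw p-values {p_H}_{H∈ℋ}, and suppose Simes' inequality holds: for every M ∈ 𝕄 with 𝒯(M) ≠ ∅, P_M(⋃_{∅≠𝒦⊆𝒯(M)} ⋂_{H∈𝒦} {p_H ≤ α·|𝒦|/|𝒯(M)|}) ≤ α. For ℛ ⊊ ℋ and i ≥ 1 define α_i(ℛ) = α / min(i, m(ℛ)) where m(ℛ) = max{|𝒯(M)| : M ∈ 𝕄, 𝒯(M) ∩ ℛ = ∅}, assuming this maximum is taken over a nonempty set and is at least 1 whenever ℛ = ℱ(M) for some M with 𝒯(M) ≠ ∅ (with the convention α_i(ℛ) = 1 when every M with 𝒯(M) ∩ ℛ = ∅ has 𝒯(M) = ∅ or no such M exists). Define the successor function 𝒩(ℛ) = ⋃{𝒦 ⊆ ℋ \ ℛ : p_H ≤ α_{|ℋ\(ℛ∪𝒦)|+1}(ℛ) for every H ∈ 𝒦}. Then the sequentially rejective procedure based on 𝒩 satisfies P_M(ℛ_∞ ⊆ ℱ(M)) ≥ 1 − α for every M ∈ 𝕄. -/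

import Mathlib

open MeasureTheory Set Classical

/-- The sequentially rejective procedure based on a (possibly random) successor
function `N`: `ℛ₀ = ∅`, `ℛ_{i+1} = ℛ_i ∪ N(ℛ_i)`. -/
def seqRej {ι Ω : Type*} (N : Set ι → Ω → Set ι) (ω : Ω) : ℕ → Set ι
  | 0 => ∅
  | n + 1 => seqRej N ω n ∪ N (seqRej N ω n) ω

/-- If every one-step successor of a subset of `F` lies in `F`, then so does the whole procedure. -/
lemma iUnion_seqRej_subset {ι Ω : Type*} {N : Set ι → Ω → Set ι} {ω : Ω} {F : Set ι}
    (h : ∀ R ⊆ F, N R ω ⊆ F) : (⋃ n, seqRej N ω n) ⊆ F := by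
  refine Set.iUnion_subset fun n => ?_
  induction n with
  | zero => exact Set.empty_subset _
  | succ n ih => exact Set.union_subset ih (h _ ih)

/-- The Shaffer step-up critical value is dominated by the Simes critical value. -/
lemma div_le_mul_div_of_add_le {α : ℝ} (hα : 0 ≤ α) {t l k : ℕ} (hl : 1 ≤ l) (hlt : l ≤ t)
    (hk : t + 1 ≤ k + l) : α / k ≤ α * l / t := by
  have hk0 : (0 : ℝ) < k := by exact_mod_cast (by omega : 0 < k)
  have ht0 : (0 : ℝ) < t := by exact_mod_cast (by omega : 0 < t)
  have hl' : (1 : ℝ) ≤ l := by exact_mod_cast hl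
  have hlt' : (l : ℝ) ≤ t := by exact_mod_cast hlt
  have hk' : (t : ℝ) + 1 ≤ k + l := by exact_mod_cast hk
  rw [div_le_div_iff₀ hk0 ht0, mul_assoc]
  refine mul_le_mul_of_nonneg_left ?_ hα
  nlinarith [mul_nonneg (sub_nonneg.2 hl') (sub_nonneg.2 hlt')]

/-- The complement of an event of probability at most `c` has probability at least `1 - c`. -/
lemma one_sub_le_measure_of_compl_subset {Ω : Type*} [MeasurableSpace Ω] {μ : Measure Ω}
    [IsProbabilityMeasure μ] {B G : Set Ω} {c : ENNReal} (hB : μ B ≤ c) (h : Bᶜ ⊆ G) :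
    1 - c ≤ μ G := by
  rw [tsub_le_iff_left, ← measure_univ (μ := μ), ← Set.union_compl_self B]
  exact (measure_union_le B Bᶜ).trans (add_le_add hB (measure_mono h))

/-- **FWER control of the sequential step-up Shaffer procedure.**  Hypotheses are
indexed by the finite type `ι` (`hyp i ⊆ 𝕄`); `𝒯(M) = {i | M ∈ hyp i}`.  Simes'
inequality is assumed for the true null hypotheses.  For `ℛ ⊊ ℋ`, the critical
values are `α_n(ℛ) = α / min(n, m(ℛ))` where
`m(ℛ) = max {|𝒯(M)| : M ∈ 𝕄, 𝒯(M) ∩ ℛ = ∅}`, whenever some `M` with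
`𝒯(M) ∩ ℛ = ∅` and `𝒯(M) ≠ ∅` exists (so that the maximum is at least 1), and
`α_n(ℛ) = 1` otherwise.  The step-up successor is
`N(ℛ) = ⋃ {𝒦 ⊆ ℋ \ ℛ : p i ≤ α_{|ℋ \ (ℛ ∪ 𝒦)| + 1}(ℛ) for all i ∈ 𝒦}`, and the
sequentially rejective procedure controls the FWER at level `α`. -/
theorem stepup_shaffer_fwer_control
    {Ω : Type*} [MeasurableSpace Ω] {𝕄 : Type*} {ι : Type*} [Fintype ι]
    (P : 𝕄 → Measure Ω) (hP : ∀ M, IsProbabilityMeasure (P M))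
    (hyp : ι → Set 𝕄) (hproper : ∀ i, hyp i ≠ Set.univ)
    (α : ℝ) (hα0 : 0 ≤ α) (hα1 : α ≤ 1)
    (p : ι → Ω → ℝ) (hpmeas : ∀ i, Measurable (p i))
    (hprange : ∀ i ω, p i ω ∈ Set.Icc (0 : ℝ) 1)
    (hpval : ∀ (M : 𝕄) (i : ι), M ∈ hyp i → ∀ u ∈ Set.Icc (0 : ℝ) 1,
      P M {ω | p i ω ≤ u} ≤ ENNReal.ofReal u)
    (hsimes : ∀ M : 𝕄, {i : ι | M ∈ hyp i} ≠ ∅ →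
      P M {ω | ∃ K : Set ι, K.Nonempty ∧ K ⊆ {i | M ∈ hyp i} ∧
          ∀ i ∈ K, p i ω ≤
            α * (Set.ncard K : ℝ) / (Set.ncard {i : ι | M ∈ hyp i} : ℝ)}
        ≤ ENNReal.ofReal α)
    (a : ℕ → Set ι → ℝ)
    (ha1 : ∀ (n : ℕ) (R : Set ι),
      (∃ M : 𝕄, (∀ i, M ∈ hyp i → i ∉ R) ∧ (∃ i, M ∈ hyp i)) →
      a n R = α / ((min n (sSup {c : ℕ | ∃ M : 𝕄, (∀ i, M ∈ hyp i → i ∉ R) ∧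
        c = Set.ncard {i : ι | M ∈ hyp i}}) : ℕ) : ℝ))
    (ha2 : ∀ (n : ℕ) (R : Set ι),
      (¬ ∃ M : 𝕄, (∀ i, M ∈ hyp i → i ∉ R) ∧ (∃ i, M ∈ hyp i)) → a n R = 1)
    (N : Set ι → Ω → Set ι)
    (hN : ∀ R ω, N R ω = ⋃₀ {K : Set ι | K ⊆ Rᶜ ∧
      ∀ i ∈ K, p i ω ≤ a (Set.ncard (R ∪ K)ᶜ + 1) R}) :
    ∀ M : 𝕄,
      1 - ENNReal.ofReal α ≤ P M {ω | (⋃ n, seqRej N ω n) ⊆ {i | M ∉ hyp i}} := by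
  intro M
  have := hP M
  set T : Set ι := {i : ι | M ∈ hyp i} with hT
  rcases T.eq_empty_or_nonempty with hTe | hTn
  · refine one_sub_le_measure_of_compl_subset (B := ∅) (by simp) fun ω _ i _ hi => ?_
    exact (hTe ▸ (show i ∈ T from hi) : i ∈ (∅ : Set ι))
  refine one_sub_le_measure_of_compl_subset (hsimes M hTn.ne_empty) fun ω hω => ?_
  refine iUnion_seqRej_subset fun R hR => ?_
  rw [hN]
  refine Set.sUnion_subset fun K hK i hiK hiM => hω ?_
  obtain ⟨-, hpK⟩ := hK
  have hTR : ∀ j, M ∈ hyp j → j ∉ R := fun j hj hjR => hR hjR hj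
  refine ⟨K ∩ T, ⟨i, hiK, hiM⟩, Set.inter_subset_right, fun j hj => ?_⟩
  refine (hpK j hj.1).trans ?_
  rw [ha1 _ _ ⟨M, hTR, i, hiM⟩]
  have hl : 1 ≤ (K ∩ T).ncard := (Set.ncard_pos (Set.toFinite _)).2 ⟨i, hiK, hiM⟩
  refine div_le_mul_div_of_add_le hα0 hl
    (Set.ncard_le_ncard Set.inter_subset_right (Set.toFinite _)) ?_
  have hm : T.ncard ≤ sSup {c : ℕ | ∃ M : 𝕄, (∀ i, M ∈ hyp i → i ∉ R) ∧
      c = Set.ncard {i : ι | M ∈ hyp i}} := by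
    refine le_csSup ⟨(Set.univ : Set ι).ncard, ?_⟩ ⟨M, hTR, rfl⟩
    rintro _ ⟨M', -, rfl⟩
    exact Set.ncard_le_ncard (Set.subset_univ _) (Set.toFinite _)
  have hn : (T \ K).ncard ≤ ((R ∪ K)ᶜ).ncard := by
    refine Set.ncard_le_ncard ?_ (Set.toFinite _)
    rintro j ⟨hjT, hjK⟩ (hjR | hjK')
    exacts [hTR j hjT hjR, hjK hjK']
  have hsplit : (T ∩ K).ncard + (T \ K).ncard = T.ncard :=
    Set.ncard_inter_add_ncard_sdiff_eq_ncard T K (Set.toFinite _)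
  rw [Set.inter_comm T K] at hsplit
  rw [← hT]
  omega
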